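/- arXiv:1310.8401 — 4 statements merged into one kernel-verified Lean document; each statement's English description precedes it below -/
import Mathlib

section
/- Let s ≥ 2 be an integer and G a finite group with d(G) > 1/s. Let N be an abelian normal nontrivial subgroup of G and suppose that G splits over N (i.e., there is a subgroup H of G with G = HN and H ∩ N = 1). Then there exists a nontrivial conjugacy class of G contained in N of size at most s − 1. -/
open MulAction

/-- Double counting of the pairs in a relation between two finite types. -/
theorem sum_card_subtype_comm {α β : Type*} [Fintype α] [Fintype β] (R : α → β → Prop) :
    ∑ a, Nat.card {b // R a b} = ∑ b, Nat.card {a // R a b} := by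
  classical
  simp only [Nat.card_eq_fintype_card, Fintype.card_subtype]
  exact Finset.sum_card_bipartiteAbove_eq_sum_card_bipartiteBelow R

/-- If a finite group acts on a finite set with a point whose stabilizer has index at least `s`,
then the sum of the squares of the stabilizer orders drops below the trivial bound by the
contribution of the orbit of that point. -/
theorem sum_sq_card_stabilizer_add_le {K X : Type*} [Group K] [Finite K] [MulAction K X]
    [Fintype X] (s : ℕ) (x₀ : X)
    (hx₀ : s * Nat.card (stabilizer K x₀) ≤ Nat.card K) :
    s * ∑ x : X, Nat.card (stabilizer K x) ^ 2 + (s - 1) * Nat.card K ^ 2 ≤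
      s * (Nat.card K * ∑ x : X, Nat.card (stabilizer K x)) := by
  classical
  set k := Nat.card K
  set t : X → ℕ := fun x ↦ Nat.card (stabilizer K x) with ht
  have hle : ∀ x, t x ≤ k := fun x ↦ Subgroup.card_le_card_group _
  have hconst : ∀ x ∈ orbit K x₀, t x = t x₀ := by
    rintro _ ⟨g, rfl⟩
    exact (Nat.card_congr (stabilizerEquivStabilizer (g := g) (a := x₀) rfl).toEquiv).symm
  have horb : Nat.card (orbit K x₀) * t x₀ = k := by
    have := (stabilizer K x₀).index_mul_card
    rwa [index_stabilizer, ← Nat.card_coe_set_eq] at this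
  have horbit : ∑ x ∈ (orbit K x₀).toFinset, t x * (k - t x) = k * (k - t x₀) := by
    rw [Finset.sum_congr rfl (g := fun _ ↦ t x₀ * (k - t x₀))]
    · rw [Finset.sum_const, smul_eq_mul, Set.toFinset_card, ← Nat.card_eq_fintype_card,
        ← mul_assoc, horb]
    · intro x hx
      rw [hconst x (by simpa using hx)]
  have hsum : k * (k - t x₀) ≤ ∑ x, t x * (k - t x) := by
    rw [← horbit]
    exact Finset.sum_le_sum_of_subset (Finset.subset_univ _)
  have hsplit : ∑ x, t x ^ 2 + ∑ x, t x * (k - t x) = k * ∑ x, t x := by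
    rw [← Finset.sum_add_distrib, Finset.mul_sum]
    refine Finset.sum_congr rfl fun x _ ↦ ?_
    obtain ⟨d, hd⟩ := Nat.exists_eq_add_of_le (hle x)
    rw [hd, Nat.add_sub_cancel_left]
    ring
  have hgap : (s - 1) * k ≤ s * (k - t x₀) := by
    rw [Nat.mul_sub, Nat.sub_mul, one_mul]
    exact Nat.sub_le_sub_left hx₀ _
  rw [← hsplit, mul_add]
  refine Nat.add_le_add_left ?_ _
  calc (s - 1) * k ^ 2 = k * ((s - 1) * k) := by ring
    _ ≤ k * (s * (k - t x₀)) := by gcongr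
    _ = s * (k * (k - t x₀)) := by ring
    _ ≤ _ := by gcongr

/-- The number of characters of `N` that are trivial on the range of `φ : M →* N`. -/
theorem card_characters_comp_eq_one {M N : Type*} [CommGroup M] [Finite M] [CommGroup N]
    [Finite N] (φ : M →* N) :
    Nat.card {χ : N →* ℂˣ // χ.comp φ = 1} * Nat.card M = Nat.card N * Nat.card φ.ker := by
  have e : {χ : N →* ℂˣ // χ.comp φ = 1} ≃ (N ⧸ φ.range →* ℂˣ) :=
    { toFun := fun χ ↦ QuotientGroup.lift φ.range χ.1 <| by
        rintro _ ⟨m, rfl⟩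
        exact DFunLike.congr_fun χ.2 m
      invFun := fun ψ ↦ ⟨ψ.comp (QuotientGroup.mk' φ.range), by
        ext m : 1
        have : ((φ m : N) : N ⧸ φ.range) = 1 := (QuotientGroup.eq_one_iff _).2 ⟨m, rfl⟩
        simp [this]⟩
      left_inv := fun χ ↦ by ext; simp
      right_inv := fun ψ ↦ by ext; simp }
  have hdual : Nat.card {χ : N →* ℂˣ // χ.comp φ = 1} = φ.range.index := by
    rw [Nat.card_congr e, CommGroup.card_monoidHom_of_hasEnoughRootsOfUnity]
    rfl
  have hker := φ.ker.index_mul_card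
  rw [Subgroup.index_ker] at hker
  rw [hdual, ← hker, ← φ.range.index_mul_card]
  ring

section Action

variable {H N : Type*} [Group H] [CommGroup N] [Finite N] [MulDistribMulAction H N]

/-- An automorphism fixes as many characters as elements. -/
theorem card_fixed_characters (h : H) :
    Nat.card {χ : N →* ℂˣ // ∀ n, χ (h • n) = χ n} = Nat.card {n : N // h • n = n} := by
  let φ : N →* N := MulDistribMulAction.toMonoidHom N h / MonoidHom.id N
  have key := card_characters_comp_eq_one φ
  have h₁ : Nat.card {χ : N →* ℂˣ // χ.comp φ = 1} =
      Nat.card {χ : N →* ℂˣ // ∀ n, χ (h • n) = χ n} :=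
    Nat.card_congr <| Equiv.subtypeEquivRight fun χ ↦ by
      simp [MonoidHom.ext_iff, φ, div_eq_one]
  have h₂ : Nat.card φ.ker = Nat.card {n : N // h • n = n} :=
    Nat.card_congr <| Equiv.subtypeEquivRight fun n ↦ by
      simp [MonoidHom.mem_ker, φ, div_eq_one]
  rw [h₁, h₂, mul_comm] at key
  exact Nat.eq_of_mul_eq_mul_left Nat.card_pos key

/-- The pairs `(a, b)` in `N × N` with `a * h₁ • b = b * h₂ • a`, counted through the characters of
`N` fixed by `h₁` and `h₂`. -/
theorem card_commuting_fiber (h₁ h₂ : H) :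
    Nat.card {q : N × N // q.1 * h₁ • q.2 = q.2 * h₂ • q.1} =
      Nat.card N * Nat.card {χ : N →* ℂˣ // (∀ n, χ (h₁ • n) = χ n) ∧ ∀ n, χ (h₂ • n) = χ n} := by
  let ψ (h : H) : N →* N := MulDistribMulAction.toMonoidHom N h / MonoidHom.id N
  let φ : N × N →* N := (ψ h₂).coprod (ψ h₁)⁻¹
  have key := card_characters_comp_eq_one φ
  have hχ : Nat.card {χ : N →* ℂˣ // χ.comp φ = 1} =
      Nat.card {χ : N →* ℂˣ // (∀ n, χ (h₁ • n) = χ n) ∧ ∀ n, χ (h₂ • n) = χ n} := by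
    refine Nat.card_congr <| Equiv.subtypeEquivRight fun χ ↦ ⟨fun hχ ↦ ⟨fun n ↦ ?_, fun n ↦ ?_⟩, ?_⟩
    · have hn : χ n / χ (h₁ • n) = 1 := by simpa [φ, ψ] using DFunLike.congr_fun hχ (1, n)
      exact (div_eq_one.1 hn).symm
    · simpa [φ, ψ, div_eq_one] using DFunLike.congr_fun hχ (n, 1)
    · rintro ⟨e₁, e₂⟩
      ext1 q
      simp [φ, ψ, e₁, e₂]
  have hker : Nat.card φ.ker = Nat.card {q : N × N // q.1 * h₁ • q.2 = q.2 * h₂ • q.1} := by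
    refine Nat.card_congr <| Equiv.subtypeEquivRight fun q ↦ ?_
    have : φ q = (q.2 * h₂ • q.1) / (q.1 * h₁ • q.2) := by
      simp only [φ, ψ, MonoidHom.coprod_apply, MonoidHom.div_apply,
        MulDistribMulAction.toMonoidHom_apply, MonoidHom.id_apply, inv_div]
      rw [div_mul_div_comm, mul_comm (h₂ • q.1)]
    rw [MonoidHom.mem_ker, this, div_eq_one, eq_comm]
  rw [hχ, hker, Nat.card_prod] at key
  refine Nat.eq_of_mul_eq_mul_left (Nat.card_pos (α := N)) ?_
  rw [← key]
  ring

/-- The count of commuting pairs in a semidirect product `N ⋊ H`, with `N` abelian, without the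
requirement that the components in `H` commute. -/
theorem mul_card_commuting_le [Finite H] [Nontrivial N] (s : ℕ) (hs : 1 ≤ s)
    (hstab : ∀ n : N, n ≠ 1 → s * Nat.card (stabilizer H n) ≤ Nat.card H) :
    s * Nat.card {p : (H × H) × (N × N) // p.2.1 * p.1.1 • p.2.2 = p.2.2 * p.1.2 • p.2.1} ≤
      Nat.card H ^ 2 * Nat.card N ^ 2 := by
  classical
  have := Fintype.ofFinite H
  have := Fintype.ofFinite N
  have hX : Nat.card (N →* ℂˣ) = Nat.card N :=
    CommGroup.card_monoidHom_of_hasEnoughRootsOfUnity N ℂ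
  have : Finite (N →* ℂˣ) := Nat.finite_of_card_ne_zero (hX ▸ Nat.card_pos.ne')
  have := Fintype.ofFinite (N →* ℂˣ)
  set c : (N →* ℂˣ) → ℕ := fun χ ↦ Nat.card {h : H // ∀ n, χ (h • n) = χ n} with hc
  have hcstab : ∀ χ : N →* ℂˣ, Nat.card (stabilizer Hᵈᵐᵃ χ) = c χ := fun χ ↦
    Nat.card_congr <| DomMulAct.mk.symm.subtypeEquiv fun h ↦ by
      simp [mem_stabilizer_iff, MonoidHom.ext_iff, DomMulAct.smul_monoidHom_apply]
  have : Finite Hᵈᵐᵃ := Finite.of_equiv H DomMulAct.mk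
  have hcardK : Nat.card Hᵈᵐᵃ = Nat.card H := Nat.card_congr DomMulAct.mk.symm
  have hsum : ∑ χ, c χ = ∑ n : N, Nat.card (stabilizer H n) := by
    simp only [hc]
    rw [sum_card_subtype_comm fun (χ : N →* ℂˣ) (h : H) ↦ ∀ n, χ (h • n) = χ n]
    simp only [card_fixed_characters]
    exact sum_card_subtype_comm fun (h : H) (n : N) ↦ h • n = n
  have hsum_sq : Nat.card {p : (H × H) × (N × N) //
      p.2.1 * p.1.1 • p.2.2 = p.2.2 * p.1.2 • p.2.1} = Nat.card N * ∑ χ, c χ ^ 2 := by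
    have e : {p : (H × H) × (N × N) // p.2.1 * p.1.1 • p.2.2 = p.2.2 * p.1.2 • p.2.1} ≃
        Σ p : H × H, {q : N × N // q.1 * p.1 • q.2 = q.2 * p.2 • q.1} :=
      Equiv.subtypeProdEquivSigmaSubtype
        fun (p : H × H) (q : N × N) ↦ q.1 * p.1 • q.2 = q.2 * p.2 • q.1
    rw [Nat.card_congr e, Nat.card_sigma]
    simp only [card_commuting_fiber]
    rw [← Finset.mul_sum, sum_card_subtype_comm fun (p : H × H) (χ : N →* ℂˣ) ↦
      (∀ n, χ (p.1 • n) = χ n) ∧ ∀ n, χ (p.2 • n) = χ n]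
    congr 1
    refine Finset.sum_congr rfl fun χ _ ↦ ?_
    rw [sq, ← Nat.card_prod]
    exact Nat.card_congr (Equiv.subtypeProdEquivProd
      (p := fun h : H ↦ ∀ n, χ (h • n) = χ n) (q := fun h : H ↦ ∀ n, χ (h • n) = χ n))
  have hone : Nat.card (stabilizer H (1 : N)) = Nat.card H := by
    have : stabilizer H (1 : N) = ⊤ := by ext; simp
    rw [this, Subgroup.card_top]
  have hcone : c 1 = Nat.card H := by
    simp only [hc]
    exact Nat.card_congr (Equiv.subtypeUnivEquiv fun h n ↦ rfl)
  have hrest : s * ∑ n ∈ Finset.univ.erase (1 : N), Nat.card (stabilizer H n) ≤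
      (Nat.card N - 1) * Nat.card H := by
    rw [Finset.mul_sum]
    refine (Finset.sum_le_card_nsmul _ _ (Nat.card H) fun n hn ↦
      hstab n (Finset.ne_of_mem_erase hn)).trans_eq ?_
    rw [Finset.card_erase_of_mem (Finset.mem_univ _), Finset.card_univ, smul_eq_mul,
      Nat.card_eq_fintype_card (α := N)]
  have hsplitN := Finset.add_sum_erase Finset.univ (fun n : N ↦ Nat.card (stabilizer H n))
    (Finset.mem_univ 1)
  have hsplitX := Finset.add_sum_erase Finset.univ c (Finset.mem_univ 1)
  have hN : 1 < Nat.card N := Finite.one_lt_card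
  obtain ⟨χ₀, hχ₀⟩ : ∃ χ, s * c χ ≤ Nat.card H := by
    by_contra! hlt
    have hcard : (Finset.univ.erase (1 : N →* ℂˣ)).card = Nat.card N - 1 := by
      rw [Finset.card_erase_of_mem (Finset.mem_univ _), Finset.card_univ,
        ← Nat.card_eq_fintype_card, hX]
    have hgt : (Nat.card N - 1) * Nat.card H < s * ∑ χ ∈ Finset.univ.erase 1, c χ := by
      rw [Finset.mul_sum, ← hcard, ← smul_eq_mul, ← Finset.sum_const]
      exact Finset.sum_lt_sum_of_nonempty (Finset.card_pos.1 (by omega)) fun χ _ ↦ hlt χ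
    have : ∑ χ ∈ Finset.univ.erase 1, c χ =
        ∑ n ∈ Finset.univ.erase (1 : N), Nat.card (stabilizer H n) := by
      omega
    rw [this] at hgt
    omega
  have main := sum_sq_card_stabilizer_add_le (K := Hᵈᵐᵃ) s χ₀ (by rwa [hcstab, hcardK])
  simp only [hcstab, hcardK] at main
  have htotal : s * ∑ χ, c χ ≤ (s - 1) * Nat.card H + Nat.card N * Nat.card H := by
    rw [hsum, ← hsplitN, hone, mul_add]
    obtain ⟨t, rfl⟩ := Nat.exists_eq_add_of_le hs
    obtain ⟨m, hm⟩ := Nat.exists_eq_add_of_le hN.le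
    rw [hm] at hrest ⊢
    simp only [Nat.add_sub_cancel_left] at hrest ⊢
    linarith
  rw [hsum_sq]
  have hfinal : s * ∑ χ, c χ ^ 2 ≤ Nat.card H ^ 2 * Nat.card N := by
    have := Nat.mul_le_mul_left (Nat.card H) htotal
    linarith
  calc s * (Nat.card N * ∑ χ, c χ ^ 2) = Nat.card N * (s * ∑ χ, c χ ^ 2) := by ring
    _ ≤ Nat.card N * (Nat.card H ^ 2 * Nat.card N) := by gcongr
    _ = _ := by ring

end Action

theorem small_class_in_normal_complemented_subgroup
    (s : ℕ) (hs : 2 ≤ s) (G : Type*) [Group G] [Finite G]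
    (hd : commProb G > 1 / (s : ℚ))
    (N : Subgroup G) [N.Normal] (hNab : ∀ a ∈ N, ∀ b ∈ N, a * b = b * a)
    (hN : N ≠ ⊥) (H : Subgroup G) (hHN : H ⊔ N = ⊤) (hHN' : H ⊓ N = ⊥) :
    ∃ g : G, g ∈ N ∧ g ≠ 1 ∧ conjugatesOf g ⊆ (N : Set G) ∧
      Nat.card (conjugatesOf g) ≤ s - 1 := by
  by_contra! hlarge
  let _ : CommGroup N :=
    { (inferInstance : Group N) with mul_comm := fun a b ↦ Subtype.ext (hNab a a.2 b b.2) }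
  let _ : MulDistribMulAction H N :=
    MulDistribMulAction.compHom N (MulAut.conjNormal.comp H.subtype : H →* MulAut N)
  have hsmul : ∀ (h : H) (n : N), ((h • n : N) : G) = h * n * (h : G)⁻¹ := fun h n ↦
    MulAut.conjNormal_apply (h : G) n
  have : Nontrivial N := (Subgroup.nontrivial_iff_ne_bot N).2 hN
  have hdisj : Disjoint N H := (disjoint_iff.2 hHN').symm
  have hdecomp : ∀ g : G, ∃ (a : N) (h : H), g = a * h := fun g ↦ by
    have hg : g ∈ N ⊔ H := by rw [sup_comm, hHN]; trivial
    obtain ⟨a, ha, h, hh, rfl⟩ := Subgroup.mem_sup_of_normal_left.1 hg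
    exact ⟨⟨a, ha⟩, ⟨h, hh⟩, rfl⟩
  have hcardG : Nat.card N * Nat.card H = Nat.card G := by
    refine (Subgroup.isComplement'_of_disjoint_and_mul_eq_univ hdisj ?_).card_mul_card
    refine Set.eq_univ_of_forall fun g ↦ ?_
    obtain ⟨a, h, rfl⟩ := hdecomp g
    exact Set.mul_mem_mul a.2 h.2
  have hstab : ∀ n : N, n ≠ 1 → s * Nat.card (stabilizer H n) ≤ Nat.card H := fun n hn ↦ by
    have hconjN : conjugatesOf (n : G) ⊆ (N : Set G) :=
      Group.conjugates_subset_normal n.2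
    have hlt := hlarge n n.2 (by simpa using hn) hconjN
    have hsub : conjugatesOf (n : G) ⊆ Subtype.val '' (orbit H n) := by
      intro g hg
      obtain ⟨x, rfl⟩ := isConj_iff.1 hg
      obtain ⟨a, h, rfl⟩ := hdecomp x
      refine ⟨h • n, ⟨h, rfl⟩, ?_⟩
      have hcomm := hNab a a.2 (h • n : N) (h • n : N).2
      rw [hsmul] at hcomm ⊢
      rw [mul_inv_rev, show (a : G) * h * n * ((h : G)⁻¹ * (a : G)⁻¹) =
        a * (h * n * (h : G)⁻¹) * (a : G)⁻¹ by group, hcomm, mul_inv_cancel_right]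
    have hle : Nat.card (conjugatesOf (n : G)) ≤ Nat.card (orbit H n) :=
      (Nat.card_mono (Set.toFinite _) hsub).trans (Nat.card_image_le (Set.toFinite _))
    have horb := (stabilizer H n).index_mul_card
    rw [index_stabilizer, ← Nat.card_coe_set_eq] at horb
    rw [← horb]
    gcongr
    omega
  have hcount := mul_card_commuting_le (H := H) (N := N) s (by omega) hstab
  choose a h hah using hdecomp
  have hcomm : ∀ x y : G, Commute x y → a x * h x • a y = a y * h y • a x := fun x y hxy ↦ by
    have heq : ((a x * h x • a y : N) : G) * (h x * h y : H) =
        ((a y * h y • a x : N) : G) * (h y * h x : H) := by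
      push_cast
      rw [hsmul, hsmul]
      calc _ = (a x * h x : G) * (a y * h y) := by group
        _ = (a y * h y) * (a x * h x) := by rw [← hah x, ← hah y, hxy.eq]
        _ = _ := by group
    exact congr_arg Prod.fst (Subgroup.mul_injective_of_disjoint hdisj
      (a₁ := (a x * h x • a y, h x * h y)) (a₂ := (a y * h y • a x, h y * h x)) heq)
  have hinj : Nat.card {p : G × G // Commute p.1 p.2} ≤
      Nat.card {p : (H × H) × (N × N) // p.2.1 * p.1.1 • p.2.2 = p.2.2 * p.1.2 • p.2.1} := by
    refine Nat.card_le_card_of_injective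
      (fun p ↦ ⟨((h p.1.1, h p.1.2), (a p.1.1, a p.1.2)), hcomm _ _ p.2⟩) ?_
    rintro ⟨⟨x, y⟩, hxy⟩ ⟨⟨x', y'⟩, hxy'⟩ heq
    simp only [Subtype.mk.injEq, Prod.mk.injEq] at heq ⊢
    obtain ⟨⟨e₁, e₂⟩, e₃, e₄⟩ := heq
    exact ⟨by rw [hah x, hah x', e₁, e₃], by rw [hah y, hah y', e₂, e₄]⟩
  have hbound : s * Nat.card {p : G × G // Commute p.1 p.2} ≤ Nat.card G ^ 2 := by
    rw [← hcardG, mul_pow, mul_comm (Nat.card N ^ 2)]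
    exact (Nat.mul_le_mul_left s hinj).trans hcount
  have hG : (0 : ℚ) < (Nat.card G : ℚ) ^ 2 := by
    have : 0 < Nat.card G := Nat.card_pos
    positivity
  have hs0 : (0 : ℚ) < s := by exact_mod_cast (by omega : 0 < s)
  rw [commProb_def, gt_iff_lt, div_lt_div_iff₀ hs0 hG, one_mul] at hd
  have : (s : ℚ) * Nat.card {p : G × G // Commute p.1 p.2} ≤ (Nat.card G : ℚ) ^ 2 := by
    exact_mod_cast hbound
  linarith
end

section
/- Let s ≥ 2 be an integer and G a finite group with d(G) > 1/s. Let N be an abelian normal nontrivial subgroup of G and suppose that G splits over N (i.e., N has a complement in G). Then either the center Z(G) is nontrivial or G has a proper subgroup of index at most s − 1. -/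
/-- The size of a conjugacy class is the index of the centralizer of a representative. -/
theorem ConjClasses.ncard_carrier_mk {G : Type*} [Group G] (g : G) :
    (ConjClasses.mk g).carrier.ncard = (Subgroup.centralizer {g}).index := by
  rw [← ConjAct.orbit_eq_carrier_conjClasses, ← MulAction.index_stabilizer,
    Subgroup.centralizer_eq_comap_stabilizer]
  exact (Subgroup.index_comap_of_surjective _ (ConjAct.toConjAct (G := G)).surjective).symm

/-- A lower bound for the order of a finite group in which every nontrivial conjugacy class has at
least `s` elements and every class in `T` has at least `s + e` elements. -/
theorem ConjClasses.card_mul_add_card_mul_add_one_le {G : Type*} [Group G] [Finite G] {s e : ℕ}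
    (hs : ∀ g : G, g ≠ 1 → s ≤ (ConjClasses.mk g).carrier.ncard)
    (T : Finset (ConjClasses G)) (hT : 1 ∉ T) (hTe : ∀ c ∈ T, s + e ≤ c.carrier.ncard) :
    Nat.card (ConjClasses G) * s + T.card * e + 1 ≤ Nat.card G + s := by
  classical
  have := Fintype.ofFinite (ConjClasses G)
  rw [← Group.sum_card_conj_classes_eq_card G, finsum_eq_sum_of_fintype]
  have key : ∀ c : ConjClasses G,
      s + (if c ∈ T then e else 0) + (if c = 1 then 1 else 0) ≤
        c.carrier.ncard + (if c = 1 then s else 0) := by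
    intro c
    by_cases h1 : c = 1
    · have h : 0 < c.carrier.ncard := by
        rw [Set.ncard_pos, h1]
        exact ⟨1, ConjClasses.mem_carrier_mk⟩
      simp [h1, hT] at h ⊢
      omega
    · by_cases h2 : c ∈ T
      · simpa [h1, h2] using hTe c h2
      · obtain ⟨g, rfl⟩ := ConjClasses.exists_rep c
        simpa [h1, h2] using hs g (by rintro rfl; exact h1 rfl)
  have := Finset.sum_le_sum fun c (_ : c ∈ Finset.univ) => key c
  simpa [Finset.sum_add_distrib, Finset.sum_ite_mem] using this

/-- If `h` is central neither modulo a normal subgroup `N` nor with respect to `N`, its conjugacy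
class has at least `2 * s` elements, where `s` bounds the indices of proper subgroups below. -/
theorem ConjClasses.two_mul_le_ncard_carrier_mk {G : Type*} [Group G] [Finite G] {s : ℕ}
    (hs : ∀ K : Subgroup G, K ≠ ⊤ → s ≤ K.index) (N : Subgroup G) [N.Normal] {h x n : G}
    (hx : x * h * x⁻¹ * h⁻¹ ∉ N) (hn : n ∈ N) (hnh : n * h ≠ h * n) :
    2 * s ≤ (ConjClasses.mk h).carrier.ncard := by
  rw [ConjClasses.ncard_carrier_mk]
  set C := Subgroup.centralizer {h}
  have htop : C ⊔ N ≠ ⊤ := by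
    intro htop
    obtain ⟨c, hc, m, hm, rfl⟩ :=
      Subgroup.mem_sup_of_normal_right.1 (htop ▸ Subgroup.mem_top x : x ∈ C ⊔ N)
    rw [Subgroup.mem_centralizer_singleton_iff] at hc
    have hc' : h * c⁻¹ * h⁻¹ = c⁻¹ := by
      rw [mul_inv_eq_iff_eq_mul, eq_inv_mul_iff_mul_eq, ← mul_assoc, hc, mul_inv_cancel_right]
    have hE : c * m * h * (c * m)⁻¹ * h⁻¹ = c * (m * (h * m⁻¹ * h⁻¹)) * c⁻¹ := by
      conv_rhs => rw [← hc']
      group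
    rw [hE] at hx
    exact hx ((inferInstance : N.Normal).conj_mem _
      (N.mul_mem hm ((inferInstance : N.Normal).conj_mem _ (N.inv_mem hm) _)) _)
  have hrel : C.relIndex (C ⊔ N) ≠ 1 := by
    rw [Ne, Subgroup.relIndex_eq_one]
    intro hle
    exact hnh (Subgroup.mem_centralizer_singleton_iff.1 (hle (Subgroup.mem_sup_right hn)))
  have hrel0 : C.relIndex (C ⊔ N) ≠ 0 :=
    Subgroup.index_ne_zero_of_finite (H := C.subgroupOf (C ⊔ N))
  rw [← Subgroup.relIndex_mul_index (le_sup_left : C ≤ C ⊔ N)]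
  exact Nat.mul_le_mul (by omega) (hs _ htop)

theorem center_nontrivial_or_small_index_subgroup
    (s : ℕ) (hs : 2 ≤ s) (G : Type*) [Group G] [Finite G]
    (hd : commProb G > 1 / (s : ℚ))
    (N : Subgroup G) [N.Normal] (hNab : ∀ a ∈ N, ∀ b ∈ N, a * b = b * a)
    (hN : N ≠ ⊥) (H : Subgroup G) (hHN : H ⊔ N = ⊤) (hHN' : H ⊓ N = ⊥) :
    Subgroup.center G ≠ ⊥ ∨ ∃ K : Subgroup G, K ≠ ⊤ ∧ K.index ≤ s - 1 := by
  classical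
  by_contra! hcon
  obtain ⟨hZ, hK⟩ := hcon
  replace hK : ∀ K : Subgroup G, K ≠ ⊤ → s ≤ K.index := fun K h => by
    have := hK K h
    omega
  have hNn : N.Normal := inferInstance
  have hcard : Nat.card G < Nat.card (ConjClasses G) * s := by
    have hG : (0 : ℚ) < Nat.card G := by exact_mod_cast Nat.card_pos
    have hs0 : (0 : ℚ) < s := by positivity
    rw [gt_iff_lt, commProb_def', div_lt_div_iff₀ hs0 hG, one_mul] at hd
    exact_mod_cast hd
  have hdec : ∀ g : G, ∃ x ∈ H, ∃ m ∈ N, x * m = g := fun g =>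
    Subgroup.mem_sup_of_normal_right.1 (hHN ▸ Subgroup.mem_top g)
  have hdisj : ∀ g ∈ H, g ∈ N → g = 1 := fun g h1 h2 => by
    rw [← Subgroup.mem_bot, ← hHN']
    exact ⟨h1, h2⟩
  have hcent : ∀ z : G, (∀ x ∈ H, Commute x z) → (∀ m ∈ N, Commute m z) → z = 1 := by
    intro z hz1 hz2
    rw [← Subgroup.mem_bot, ← hZ, Subgroup.mem_center_iff]
    intro g
    obtain ⟨x, hx, m, hm, rfl⟩ := hdec g
    exact (hz1 x hx).mul_left (hz2 m hm)
  have hcl : ∀ g : G, g ≠ 1 → s ≤ (ConjClasses.mk g).carrier.ncard := by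
    intro g hg
    rw [ConjClasses.ncard_carrier_mk]
    refine hK _ fun htop => hg ?_
    have hc : ∀ x, Commute x g := fun x =>
      Subgroup.mem_centralizer_singleton_iff.1 (htop ▸ Subgroup.mem_top x)
    exact hcent g (fun x _ => hc x) fun x _ => hc x
  -- An element of `H` is central in `H` or centralizes `N`.
  have hor : ∀ h ∈ H, (∀ x ∈ H, Commute x h) ∨ ∀ m ∈ N, Commute m h := by
    intro h hh
    by_contra! hbad
    obtain ⟨⟨x, hx, hxh⟩, n, hn, hnh⟩ := hbad
    have hxN : x * h * x⁻¹ * h⁻¹ ∉ N := fun hmem => hxh <| by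
      have := hdisj _ (H.mul_mem (H.mul_mem (H.mul_mem hx hh) (H.inv_mem hx)) (H.inv_mem hh)) hmem
      rwa [mul_inv_eq_one, mul_inv_eq_iff_eq_mul] at this
    have hbig := ConjClasses.two_mul_le_ncard_carrier_mk hK N hxN hn hnh
    have h1 : h ≠ 1 := by rintro rfl; exact hxh (Commute.one_right x)
    have := ConjClasses.card_mul_add_card_mul_add_one_le (e := s) hcl {ConjClasses.mk h}
      (by
        rw [Finset.mem_singleton, ConjClasses.one_eq_mk_one, ConjClasses.mk_eq_mk_iff_isConj]
        exact fun hc => h1 (isConj_one_right.1 hc))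
      (by simpa [two_mul] using hbig)
    simp at this
    omega
  obtain ⟨n₁, hn₁, hn₁'⟩ := N.bot_or_exists_ne_one.resolve_left hN
  have hHab : ∀ h ∈ H, ∀ x ∈ H, Commute x h := by
    by_contra! hne
    obtain ⟨h, hh, x, hx, hxh⟩ := hne
    have hhN := (hor h hh).resolve_left fun hc => hxh (hc x hx)
    refine hn₁' (hcent n₁ (fun y hy => ?_) fun m hm => hNab m hm n₁ hn₁)
    rcases hor y hy with hyH | hyN
    · rcases hor (h * y) (H.mul_mem hh hy) with hc | hc
      · refine absurd ?_ hxh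
        have := (hc x hx).mul_right (hyH x hx).inv_right
        rwa [mul_inv_cancel_right] at this
      · have := (hhN n₁ hn₁).inv_right.mul_right (hc n₁ hn₁)
        rw [inv_mul_cancel_left] at this
        exact this.symm
    · exact (hyN n₁ hn₁).symm
  have hNtop : N ≠ ⊤ := fun htop =>
    hn₁' (hcent n₁ (fun x _ => hNab x (htop ▸ Subgroup.mem_top x) n₁ hn₁)
      fun m hm => hNab m hm n₁ hn₁)
  have hcompl : H.IsComplement' N :=
    Subgroup.isComplement'_of_disjoint_and_mul_eq_univ (disjoint_iff.2 hHN')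
      (by rw [← Subgroup.mul_normal, hHN, Subgroup.coe_top])
  have hcardH : s ≤ Nat.card H := by
    rw [← hcompl.index_eq_card]
    exact hK N hNtop
  have hconjN : ∀ h ∈ H, ∀ g : G, g * h * g⁻¹ * h⁻¹ ∈ N := by
    intro h hh g
    obtain ⟨x, hx, m, hm, rfl⟩ := hdec g
    have hxh : h * x⁻¹ * h⁻¹ = x⁻¹ := by
      rw [((hHab h hh x hx).inv_left).symm.eq, mul_inv_cancel_right]
    have hE : x * m * h * (x * m)⁻¹ * h⁻¹ = x * (m * (h * m⁻¹ * h⁻¹)) * x⁻¹ := by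
      conv_rhs => rw [← hxh]
      group
    rw [hE]
    exact hNn.conj_mem _ (N.mul_mem hm (hNn.conj_mem _ (N.inv_mem hm) _)) _
  have hinj : Set.InjOn (ConjClasses.mk : G → ConjClasses G) H := by
    intro h hh h' hh' heq
    obtain ⟨g, hg⟩ := isConj_iff.1 (ConjClasses.mk_eq_mk_iff_isConj.1 heq)
    have := hconjN h hh g
    rw [hg] at this
    exact (mul_inv_eq_one.1 (hdisj _ (H.mul_mem hh' (H.inv_mem hh)) this)).symm
  have hbig : ∀ h ∈ H, h ≠ 1 → s + 1 ≤ (ConjClasses.mk h).carrier.ncard := by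
    intro h hh h1
    obtain ⟨n, hn, hnh⟩ : ∃ n ∈ N, ¬ Commute n h := by
      by_contra! hall
      exact h1 (hcent h (hHab h hh) hall)
    set c := n * h * n⁻¹ * h⁻¹ with hc
    have hcN : c ∈ N := hconjN h hh n
    have hc1 : c ≠ 1 := fun hc1 => hnh <| by
      rwa [hc, mul_inv_eq_one, mul_inv_eq_iff_eq_mul] at hc1
    have hnot : (1 : G) ∉ (ConjClasses.mk c).carrier := fun hmem => by
      rw [ConjClasses.mem_carrier_iff_mk_eq, ConjClasses.mk_eq_mk_iff_isConj] at hmem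
      exact hc1 (isConj_one_right.1 hmem)
    have hsub : (· * h) '' insert 1 (ConjClasses.mk c).carrier ⊆ (ConjClasses.mk h).carrier := by
      rintro _ ⟨y, hy, rfl⟩
      rw [ConjClasses.mem_carrier_iff_mk_eq, eq_comm, ConjClasses.mk_eq_mk_iff_isConj, isConj_iff]
      rcases hy with rfl | hy
      · exact ⟨1, by simp⟩
      · rw [ConjClasses.mem_carrier_iff_mk_eq, eq_comm, ConjClasses.mk_eq_mk_iff_isConj,
          isConj_iff] at hy
        obtain ⟨g, rfl⟩ := hy
        obtain ⟨x, hx, m, hm, rfl⟩ := hdec g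
        refine ⟨x * n * x⁻¹, ?_⟩
        have hmc : m * c * m⁻¹ = c := mul_inv_eq_iff_eq_mul.2 (hNab m hm c hcN)
        have hxh : x⁻¹ * h * x = h := by
          rw [mul_assoc, ← (hHab h hh x hx).eq, inv_mul_cancel_left]
        calc x * n * x⁻¹ * h * (x * n * x⁻¹)⁻¹
            = x * (n * (x⁻¹ * h * x) * n⁻¹) * x⁻¹ := by group
          _ = x * (c * h) * x⁻¹ := by rw [hxh, hc, inv_mul_cancel_right]
          _ = x * c * (h * x⁻¹) := by group
          _ = x * c * (x⁻¹ * h) := by rw [((hHab h hh x hx).inv_left).eq]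
          _ = x * (m * c * m⁻¹) * (x⁻¹ * h) := by rw [hmc]
          _ = x * m * c * (x * m)⁻¹ * h := by group
    have hle := Set.ncard_le_ncard hsub
    rw [Set.ncard_image_of_injective _ (mul_left_injective h), Set.ncard_insert_of_notMem hnot]
      at hle
    exact (Nat.succ_le_succ (hcl c hc1)).trans hle
  have := Fintype.ofFinite G
  let S : Finset G := (H : Set G).toFinset.erase 1
  have hS : ∀ h ∈ S, h ≠ 1 ∧ h ∈ H := fun h hh => by simpa [S] using hh
  have hScard : S.card + 1 = Nat.card H := by
    rw [Finset.card_erase_add_one (by simp [H.one_mem]), Set.toFinset_card,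
      ← Nat.card_eq_fintype_card]
    rfl
  have hle := ConjClasses.card_mul_add_card_mul_add_one_le (e := 1) hcl (S.image ConjClasses.mk)
    (by
      rw [Finset.mem_image]
      rintro ⟨h, hh, h1⟩
      exact (hS h hh).1 (hinj (hS h hh).2 H.one_mem h1))
    (by
      intro c hc
      obtain ⟨h, hh, rfl⟩ := Finset.mem_image.1 hc
      exact hbig h (hS h hh).2 (hS h hh).1)
  rw [Finset.card_image_of_injOn fun a ha b hb => hinj (hS a ha).2 (hS b hb).2] at hle
  omega
end

section
/- Let G be a finite group with d(G) > 5/16. Then the commutator subgroup [G,G] has order less than 12. -/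
/-- The element `∑ g, f [g] • g` of the group algebra attached to a class function `f`. -/
noncomputable def ConjClasses.toMonoidAlgebra (k G : Type*) [Field k] [Group G] [Fintype G] :
    (ConjClasses G → k) →ₗ[k] MonoidAlgebra k G :=
  (MonoidAlgebra.basis G k).equivFun.symm.toLinearMap ∘ₗ LinearMap.funLeft k k ConjClasses.mk

section ClassFunctions

variable {k G : Type*} [Field k] [Group G] [Fintype G]

theorem ConjClasses.toMonoidAlgebra_apply (f : ConjClasses G → k) :
    toMonoidAlgebra k G f = ∑ g, MonoidAlgebra.single g (f (ConjClasses.mk g)) := by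
  simp [toMonoidAlgebra, Module.Basis.equivFun_symm_apply, LinearMap.funLeft_apply]

theorem ConjClasses.toMonoidAlgebra_injective :
    Function.Injective (toMonoidAlgebra k G) :=
  (MonoidAlgebra.basis G k).equivFun.symm.injective.comp
    (LinearMap.funLeft_injective_of_surjective k k _ ConjClasses.mk_surjective)

theorem ConjClasses.toMonoidAlgebra_commute (f : ConjClasses G → k) (a : MonoidAlgebra k G) :
    Commute a (toMonoidAlgebra k G f) := by
  suffices LinearMap.mulRight k (toMonoidAlgebra k G f) =
      LinearMap.mulLeft k (toMonoidAlgebra k G f) from LinearMap.congr_fun this a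
  refine (MonoidAlgebra.basis G k).ext fun h ↦ ?_
  simp only [MonoidAlgebra.basis_apply, LinearMap.mulRight_apply, LinearMap.mulLeft_apply,
    toMonoidAlgebra_apply, Finset.mul_sum, Finset.sum_mul, MonoidAlgebra.single_mul_single,
    one_mul, mul_one]
  refine Fintype.sum_equiv (MulAut.conj h).toEquiv _ _ fun g ↦ ?_
  have hg : ConjClasses.mk (h * g * h⁻¹) = ConjClasses.mk g :=
    ConjClasses.mk_eq_mk_iff_isConj.2 (isConj_iff.2 ⟨h, rfl⟩).symm
  simp [hg]

end ClassFunctions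

section Blocks

variable {k G : Type*} [Field k] [Group G] {n : ℕ} {d : Fin n → ℕ}

theorem card_eq_sum_sq_of_algEquiv_pi_matrix
    (e : MonoidAlgebra k G ≃ₐ[k] Π i, Matrix (Fin (d i)) (Fin (d i)) k) :
    Nat.card G = ∑ i, d i ^ 2 := by
  have h := e.toLinearEquiv.finrank_eq
  rw [Module.finrank_eq_nat_card_basis (MonoidAlgebra.basis G k)] at h
  simpa [Module.finrank_pi_fintype, Module.finrank_matrix, sq] using h

/-- The number of conjugacy classes is at most the number of Wedderburn blocks. -/
theorem card_conjClasses_le_of_algEquiv_pi_matrix [Finite G] [∀ i, NeZero (d i)]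
    (e : MonoidAlgebra k G ≃ₐ[k] Π i, Matrix (Fin (d i)) (Fin (d i)) k) :
    Nat.card (ConjClasses G) ≤ n := by
  have := Fintype.ofFinite G
  have := Fintype.ofFinite (ConjClasses G)
  let corner : (Π i, Matrix (Fin (d i)) (Fin (d i)) k) →ₗ[k] Fin n → k :=
    { toFun := fun M i ↦ M i 0 0
      map_add' := fun _ _ ↦ rfl
      map_smul' := fun _ _ ↦ rfl }
  have hinj : Function.Injective
      (corner ∘ₗ e.toLinearMap ∘ₗ ConjClasses.toMonoidAlgebra k G) := by
    rw [← LinearMap.ker_eq_bot, LinearMap.ker_eq_bot']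
    intro f hf
    refine ConjClasses.toMonoidAlgebra_injective (e.injective ?_)
    rw [map_zero, map_zero]
    funext i
    have hcenter : e (ConjClasses.toMonoidAlgebra k G f) i ∈
        Set.center (Matrix (Fin (d i)) (Fin (d i)) k) := by
      rw [Semigroup.mem_center_iff]
      intro M
      have h := (ConjClasses.toMonoidAlgebra_commute f (e.symm (Pi.single i M))).map e
      simpa using congrFun h.eq i
    rw [Matrix.center_eq_range] at hcenter
    obtain ⟨c, hc⟩ := hcenter
    have hzero : e (ConjClasses.toMonoidAlgebra k G f) i 0 0 = 0 := congrFun hf i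
    rw [← hc] at hzero ⊢
    have hc0 : c = 0 := by simpa using hzero
    simp [hc0]
  simpa [Nat.card_eq_fintype_card] using LinearMap.finrank_le_finrank_of_injective hinj

/-- The number of one-dimensional Wedderburn blocks is at most the order of the abelianization. -/
theorem card_filter_eq_one_le_of_algEquiv_pi_matrix [Finite G]
    (e : MonoidAlgebra ℂ G ≃ₐ[ℂ] Π i, Matrix (Fin (d i)) (Fin (d i)) ℂ) :
    (Finset.univ.filter fun i ↦ d i = 1).card ≤ Nat.card (Abelianization G) := by
  let χ (i : Fin n) : G →* ℂ :=
    (Matrix.detMonoidHom.comp (Pi.evalMonoidHom _ i)).comp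
      ((e : MonoidAlgebra ℂ G →* Π i, Matrix (Fin (d i)) (Fin (d i)) ℂ).comp
        (MonoidAlgebra.of ℂ G))
  let tr (i : Fin n) : MonoidAlgebra ℂ G →ₗ[ℂ] ℂ :=
    Matrix.traceLinearMap (Fin (d i)) ℂ ℂ ∘ₗ LinearMap.proj i ∘ₗ e.toLinearMap
  have hχ (i : Fin n) (hi : d i = 1) (g : G) : χ i g = tr i (MonoidAlgebra.single g 1) := by
    have : Unique (Fin (d i)) := by rw [hi]; infer_instance
    simp [χ, tr, Matrix.det_unique, Matrix.trace]
  have hinj : Function.Injective fun i : {i // d i = 1} ↦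
      Abelianization.lift (χ i).toHomUnits := by
    rintro ⟨i, hi⟩ ⟨j, hj⟩ hij
    have hχij : χ i = χ j :=
      MonoidHom.toHomUnitsMulEquiv.injective (Abelianization.lift.injective hij)
    have htr : tr i = tr j := (MonoidAlgebra.basis G ℂ).ext fun g ↦ by
      rw [MonoidAlgebra.basis_apply, ← hχ i hi, ← hχ j hj, hχij]
    by_contra hne
    have hne' : j ≠ i := fun h ↦ hne (Subtype.ext h.symm)
    simpa [tr, hi, hne'] using LinearMap.congr_fun htr (e.symm (Pi.single i 1))
  have hcard := CommGroup.card_monoidHom_of_hasEnoughRootsOfUnity (Abelianization G) ℂ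
  have : Finite (Abelianization G →* ℂˣ) := Nat.finite_of_card_ne_zero (hcard ▸ Nat.card_pos.ne')
  rw [← hcard, ← Fintype.card_subtype, ← Nat.card_eq_fintype_card]
  exact Nat.card_le_card_of_injective _ hinj

end Blocks

theorem four_mul_card_conjClasses_le (G : Type*) [Group G] [Finite G] :
    4 * Nat.card (ConjClasses G) ≤ Nat.card G + 3 * Nat.card (Abelianization G) := by
  obtain ⟨n, d, hd, ⟨e⟩⟩ :=
    IsSemisimpleRing.exists_algEquiv_pi_matrix_of_isAlgClosed ℂ (MonoidAlgebra ℂ G)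
  have hblocks := card_conjClasses_le_of_algEquiv_pi_matrix e
  have hlinear := card_filter_eq_one_le_of_algEquiv_pi_matrix e
  have hsum : ∑ _i : Fin n, 4 ≤ ∑ i, (d i ^ 2 + 3 * if d i = 1 then 1 else 0) := by
    refine Finset.sum_le_sum fun i _ ↦ ?_
    have := (hd i).pos
    split_ifs with h
    · simp [h]
    · have : 2 ≤ d i := by omega
      nlinarith
  rw [Finset.sum_add_distrib, ← Finset.mul_sum, ← Finset.card_filter,
    ← card_eq_sum_sq_of_algEquiv_pi_matrix e] at hsum
  simp only [Finset.sum_const, Finset.card_univ, Fintype.card_fin, smul_eq_mul] at hsum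
  omega

theorem card_commutator_lt_twelve (G : Type*) [Group G] [Finite G]
    (h : commProb G > 5 / 16) :
    Nat.card (commutator G) < 12 := by
  have hpos : (0 : ℚ) < Nat.card G := by exact_mod_cast Nat.card_pos
  rw [commProb_def', gt_iff_lt, lt_div_iff₀ hpos] at h
  have hclasses : 5 * Nat.card G < 16 * Nat.card (ConjClasses G) := by
    have : (5 * Nat.card G : ℚ) < 16 * Nat.card (ConjClasses G) := by linarith
    exact_mod_cast this
  have hbound := four_mul_card_conjClasses_le G
  have hmul : Nat.card G = Nat.card (Abelianization G) * Nat.card (commutator G) :=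
    (commutator G).card_eq_card_quotient_mul_card_subgroup
  by_contra! hge
  have := Nat.mul_le_mul_left (Nat.card (Abelianization G)) hge
  omega
end

section
/- Let G be a finite group of odd order with d(G) > 35/243. Then the commutator subgroup [G,G] has order less than 27. -/
open Matrix in
/-- The first orthogonality relation for the character of a matrix representation
whose commutant consists of scalars. -/
theorem sum_trace_mul_trace_inv {G n : Type*} [Group G] [Fintype G] [Fintype n] [DecidableEq n]
    [Nonempty n] (ρ : G →* Matrix n n ℂ)
    (schur : ∀ M, (∀ g, Commute (ρ g) M) → ∃ c, M = scalar n c) :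
    ∑ g, (ρ g).trace * (ρ g⁻¹).trace = Fintype.card G := by
  have average (X : Matrix n n ℂ) : ∑ g, ρ g * X * ρ g⁻¹ =
      scalar n (Fintype.card G * X.trace / Fintype.card n) := by
    obtain ⟨c, hc⟩ := schur (∑ g, ρ g * X * ρ g⁻¹) fun h ↦ by
      rw [Commute, SemiconjBy, Finset.mul_sum, Finset.sum_mul]
      refine Fintype.sum_equiv (Equiv.mulLeft h) _ _ fun g ↦ ?_
      simp only [Equiv.coe_mulLeft, map_mul, _root_.mul_inv_rev, mul_assoc]
      rw [← map_mul ρ h⁻¹ h, inv_mul_cancel, map_one, mul_one]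
    have htrace : Fintype.card G * X.trace = c * Fintype.card n := by
      have := congrArg trace hc
      simp_rw [trace_sum, fun g ↦ trace_mul_cycle (ρ g) X (ρ g⁻¹), ← map_mul, inv_mul_cancel,
        map_one, one_mul] at this
      simpa [trace, mul_comm] using this
    rw [hc, htrace, mul_div_cancel_right₀]
    exact_mod_cast Fintype.card_ne_zero
  have entry (i j : n) : ∑ g, ρ g i i * ρ g⁻¹ j j =
      if i = j then (Fintype.card G / Fintype.card n : ℂ) else 0 := by
    have := congrFun (congrFun (average (single i j 1)) i) j
    rw [Matrix.sum_apply] at this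
    rcases eq_or_ne i j with rfl | hij
    · simpa [mul_apply, single_apply, ite_and] using this
    · simpa [mul_apply, single_apply, ite_and, hij] using this
  simp_rw [trace, diag, Finset.sum_mul_sum]
  rw [Finset.sum_comm]
  simp_rw [fun i ↦ Finset.sum_comm (s := Finset.univ) (t := Finset.univ)
    (f := fun g j ↦ ρ g i i * ρ g⁻¹ j j), entry]
  simp [mul_div_cancel₀]

open Matrix in
/-- A group of odd order has no irreducible representation in `SL₂(ℂ)`. -/
theorem not_schur_of_odd_card_of_det_eq_one {G : Type*} [Group G] [Fintype G]
    (hodd : Odd (Nat.card G)) (ρ : G →* Matrix (Fin 2) (Fin 2) ℂ) (hdet : ∀ g, (ρ g).det = 1) :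
    ¬ ∀ M, (∀ g, Commute (ρ g) M) → ∃ c, M = scalar (Fin 2) c := by
  intro schur
  have translate (h : G) : ρ h * ∑ g, ρ g = ∑ g, ρ g := by
    rw [Finset.mul_sum]
    exact Fintype.sum_equiv (Equiv.mulLeft h) _ _ fun g ↦ by simp
  have hsum : ∑ g, ρ g = 0 := by
    obtain ⟨c, hc⟩ := schur (∑ g, ρ g) fun h ↦ by
      rw [Commute, SemiconjBy, translate, Finset.sum_mul]
      exact (Fintype.sum_equiv (Equiv.mulRight h) _ _ fun g ↦ by simp).symm
    by_contra hne
    have hc0 : c ≠ 0 := fun h0 ↦ hne (by rw [hc, h0, map_zero])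
    have htriv (h : G) : ρ h = 1 := by
      have := translate h
      rw [hc, scalar_apply, ← smul_one_eq_diagonal, mul_smul_comm, mul_one] at this
      exact smul_right_injective _ hc0 this
    obtain ⟨d, hd⟩ := schur (single 0 1 1) fun g ↦ by rw [htriv]; exact Commute.one_left _
    simpa using congrFun (congrFun hd 0) 1
  have hsq : ∑ g, (ρ (g ^ 2)).trace = 0 := by
    rw [Fintype.sum_equiv (powCoprime (n := 2) (Nat.coprime_two_right.mpr hodd))
      (fun g ↦ (ρ (g ^ 2)).trace) (fun g ↦ (ρ g).trace) fun g ↦ rfl, ← trace_sum, hsum,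
      trace_zero]
  have hpoint (g : G) : (ρ g).trace * (ρ g⁻¹).trace = (ρ (g ^ 2)).trace + 2 := by
    have hinv : ρ g⁻¹ = (ρ g).adjugate := by
      have h1 : ρ g * ρ g⁻¹ = 1 := by rw [← map_mul, mul_inv_cancel, map_one]
      calc ρ g⁻¹ = (ρ g).adjugate * ρ g * ρ g⁻¹ := by
            rw [adjugate_mul, hdet, one_smul, one_mul]
        _ = _ := by rw [mul_assoc, h1, mul_one]
    have hd := hdet g
    rw [det_fin_two] at hd
    rw [hinv, map_pow, pow_two, trace_fin_two, trace_fin_two, trace_fin_two, adjugate_fin_two]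
    simp only [mul_apply, Fin.sum_univ_two, of_apply, cons_val_zero, cons_val_one, cons_val',
      cons_val_fin_one]
    linear_combination 2 * hd
  have h2 := sum_trace_mul_trace_inv ρ schur
  simp_rw [hpoint, Finset.sum_add_distrib, hsq] at h2
  simp at h2

open Matrix in
/-- A group of odd order has no irreducible complex representation of degree two. -/
theorem not_schur_of_odd_card {G : Type*} [Group G] [Finite G]
    (hodd : Odd (Nat.card G)) (ρ : G →* Matrix (Fin 2) (Fin 2) ℂ) :
    ¬ ∀ M, (∀ g, Commute (ρ g) M) → ∃ c, M = scalar (Fin 2) c := by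
  intro schur
  have := Fintype.ofFinite G
  obtain ⟨k, hk⟩ := id hodd
  let χ : G →* ℂ := (detMonoidHom.comp ρ) ^ k
  have hχ (g : G) : χ g = (ρ g).det ^ k := rfl
  have hpow (g : G) : (ρ g).det ^ (2 * k + 1) = 1 := by
    rw [← hk, ← det_pow, ← map_pow, pow_card_eq_one', map_one, det_one]
  have hχ0 (g : G) : χ g ≠ 0 := fun h0 ↦ by
    have : χ (g * g⁻¹) = 0 := by rw [map_mul, h0, zero_mul]
    simp at this
  let σ : G →* Matrix (Fin 2) (Fin 2) ℂ :=
    { toFun := fun g ↦ χ g • ρ g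
      map_one' := by simp
      map_mul' := fun g h ↦ by simp [mul_smul_mul_comm] }
  have hσ (g : G) : σ g = χ g • ρ g := rfl
  refine not_schur_of_odd_card_of_det_eq_one hodd σ (fun g ↦ ?_) fun M hM ↦ schur M fun g ↦ ?_
  · rw [hσ, det_smul, hχ, Fintype.card_fin, ← hpow g]
    ring
  · exact (Commute.smul_left_iff₀ (hχ0 g)).mp (hM g)

/-- The number of conjugacy classes is at most the number of Wedderburn blocks. -/
theorem card_conjClasses_le_of_algEquiv {G : Type*} [Group G] [Finite G] {n : ℕ} {d : Fin n → ℕ}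
    [∀ i, NeZero (d i)]
    (e : MonoidAlgebra ℂ G ≃ₐ[ℂ] Π i, Matrix (Fin (d i)) (Fin (d i)) ℂ) :
    Nat.card (ConjClasses G) ≤ n := by
  classical
  have := Fintype.ofFinite G
  have := Fintype.ofFinite (ConjClasses G)
  let classSum : (ConjClasses G → ℂ) →ₗ[ℂ] MonoidAlgebra ℂ G :=
    { toFun := fun f ↦ ∑ g, MonoidAlgebra.single g (f (ConjClasses.mk g))
      map_add' := fun f f' ↦ by simp [Finset.sum_add_distrib]
      map_smul' := fun c f ↦ by simp [Finset.smul_sum] }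
  have classSum_apply (f) : classSum f = ∑ g, MonoidAlgebra.single g (f (ConjClasses.mk g)) := rfl
  have classSum_comm (f) (h : G) : Commute (classSum f) (MonoidAlgebra.single h 1) := by
    rw [Commute, SemiconjBy, classSum_apply, Finset.mul_sum, Finset.sum_mul]
    refine Fintype.sum_equiv (MulAut.conj h⁻¹).toEquiv _ _ fun g ↦ ?_
    have hconj : ConjClasses.mk (h⁻¹ * (g * h)) = ConjClasses.mk g :=
      ConjClasses.mk_eq_mk_iff_isConj.mpr (isConj_iff.mpr ⟨h, by simp [mul_assoc]⟩)
    simp [MonoidAlgebra.single_mul_single, mul_assoc, hconj]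
  have classSum_central (f) (a : MonoidAlgebra ℂ G) : Commute (classSum f) a := by
    induction a using MonoidAlgebra.induction_linear with
    | zero => exact Commute.zero_right _
    | add a b ha hb => exact ha.add_right hb
    | single g c => simpa using (classSum_comm f g).smul_right c
  let corner : (ConjClasses G → ℂ) →ₗ[ℂ] (Fin n → ℂ) :=
    LinearMap.pi fun i ↦ (Matrix.entryLinearMap ℂ ℂ 0 0).comp
      ((LinearMap.proj i).comp (e.toLinearMap.comp classSum))
  have corner_apply (f i) : corner f i = e (classSum f) i 0 0 := rfl
  have hinj : Function.Injective corner := by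
    rw [injective_iff_map_eq_zero]
    intro f hf
    have hzero : e (classSum f) = 0 := by
      funext i
      have hcenter : e (classSum f) i ∈ Set.center (Matrix (Fin (d i)) (Fin (d i)) ℂ) := by
        rw [Semigroup.mem_center_iff]
        intro M
        have := congrFun ((classSum_central f (e.symm (Pi.single i M))).map e).eq i
        simpa using this.symm
      rw [Matrix.center_eq_range] at hcenter
      obtain ⟨c, hc⟩ := hcenter
      have h0 := congrFun hf i
      rw [corner_apply, ← hc] at h0
      have : c = 0 := by simpa using h0
      rw [← hc, this, map_zero, Pi.zero_apply]
    have hclass : classSum f = 0 := by simpa using hzero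
    funext x
    obtain ⟨g, rfl⟩ := ConjClasses.exists_rep x
    have := congrArg (fun a ↦ a.coeff g) hclass
    simpa [classSum_apply, Finsupp.single_apply] using this
  simpa [Nat.card_eq_fintype_card] using LinearMap.finrank_le_finrank_of_injective hinj

/-- The number of Wedderburn blocks of size one is at most the index of the commutator subgroup. -/
theorem card_blocks_one_le_of_algEquiv {G : Type*} [Group G] [Finite G] {n : ℕ} {d : Fin n → ℕ}
    (e : MonoidAlgebra ℂ G ≃ₐ[ℂ] Π i, Matrix (Fin (d i)) (Fin (d i)) ℂ) :
    (Finset.univ.filter fun i ↦ d i = 1).card ≤ (commutator G).index := by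
  have hcard : Nat.card (G →* ℂˣ) = (commutator G).index := by
    rw [Nat.card_congr Abelianization.lift,
      CommGroup.card_monoidHom_of_hasEnoughRootsOfUnity]
    rfl
  have hfin : Finite (G →* ℂˣ) := Nat.finite_of_card_ne_zero (by
    rw [hcard]; exact Subgroup.FiniteIndex.index_ne_zero)
  let block (i : Fin n) : MonoidAlgebra ℂ G →ₐ[ℂ] Matrix (Fin (d i)) (Fin (d i)) ℂ :=
    (Pi.evalAlgHom ℂ _ i).comp e.toAlgHom
  let χ (i : Fin n) : G →* ℂˣ :=
    MonoidHom.toHomUnits (Matrix.detMonoidHom.comp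
      ((block i : _ →* Matrix (Fin (d i)) (Fin (d i)) ℂ).comp (MonoidAlgebra.of ℂ G)))
  have hχ (i : Fin n) (g : G) : (χ i g : ℂ) = (e (MonoidAlgebra.single g 1) i).det := rfl
  rw [← hcard, ← Fintype.card_coe, ← Nat.card_eq_fintype_card]
  refine Nat.card_le_card_of_injective 
    (fun i : {i // i ∈ Finset.univ.filter fun i ↦ d i = 1} ↦ χ i) ?_
  rintro ⟨i, hi⟩ ⟨j, hj⟩ hij
  rw [Finset.mem_filter_univ] at hi hj
  by_contra hne
  have hne : i ≠ j := fun h ↦ hne (Subtype.ext h)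
  have hentry (m : ℕ) (hm : m = 1) (M : Matrix (Fin m) (Fin m) ℂ) :
      M.det = M ⟨0, by omega⟩ ⟨0, by omega⟩ := by
    subst hm
    simp
  have hall (a : MonoidAlgebra ℂ G) :
      e a i ⟨0, by omega⟩ ⟨0, by omega⟩ = e a j ⟨0, by omega⟩ ⟨0, by omega⟩ := by
    induction a using MonoidAlgebra.induction_linear with
    | zero => simp
    | add a b ha hb => simp [ha, hb]
    | single g c =>
      have hg : (χ i g : ℂ) = χ j g := by rw [show χ i = χ j from hij]
      rw [hχ, hχ, hentry _ hi, hentry _ hj] at hg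
      have hs : MonoidAlgebra.single g c = c • MonoidAlgebra.single g (1 : ℂ) := by simp
      rw [hs, map_smul]
      simp [hg]
  have := hall (e.symm (Pi.single i 1))
  simp [hne.symm] at this

/-- A group of odd order has no Wedderburn block of size two. -/
theorem block_ne_two_of_algEquiv {G : Type*} [Group G] [Finite G] (hodd : Odd (Nat.card G))
    {n : ℕ} {d : Fin n → ℕ}
    (e : MonoidAlgebra ℂ G ≃ₐ[ℂ] Π i, Matrix (Fin (d i)) (Fin (d i)) ℂ) (i : Fin n) : d i ≠ 2 := by
  intro hi
  let φ : MonoidAlgebra ℂ G →ₐ[ℂ] Matrix (Fin 2) (Fin 2) ℂ :=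
    ((Matrix.reindexAlgEquiv ℂ ℂ (finCongr hi)).toAlgHom.comp (Pi.evalAlgHom ℂ _ i)).comp e.toAlgHom
  have hφ : Function.Surjective φ :=
    ((Matrix.reindexAlgEquiv ℂ ℂ (finCongr hi)).surjective.comp
      (Function.surjective_eval (β := fun i ↦ Matrix (Fin (d i)) (Fin (d i)) ℂ) i)).comp e.surjective
  refine not_schur_of_odd_card hodd ((φ : _ →* _).comp (MonoidAlgebra.of ℂ G)) fun M hM ↦ ?_
  have hall (a : MonoidAlgebra ℂ G) : Commute (φ a) M := by
    induction a using MonoidAlgebra.induction_linear with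
    | zero => rw [map_zero]; exact Commute.zero_left _
    | add a b ha hb => rw [map_add]; exact ha.add_left hb
    | single g c =>
      have hs : MonoidAlgebra.single g c = c • MonoidAlgebra.single g (1 : ℂ) := by simp
      rw [hs, map_smul]
      exact (hM g).smul_left c
  have hcenter : M ∈ Set.center (Matrix (Fin 2) (Fin 2) ℂ) := by
    rw [Semigroup.mem_center_iff]
    intro N
    obtain ⟨a, rfl⟩ := hφ N
    exact (hall a).eq
  rw [Matrix.center_eq_range] at hcenter
  obtain ⟨c, hc⟩ := hcenter
  exact ⟨c, hc.symm⟩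

/-- In a group of odd order, all irreducible characters of degree greater than one have degree
at least three, which bounds the number of conjugacy classes. -/
theorem nine_mul_card_conjClasses_le {G : Type*} [Group G] [Finite G]
    (hodd : Odd (Nat.card G)) :
    9 * Nat.card (ConjClasses G) ≤ Nat.card G + 8 * (commutator G).index := by
  have := Fintype.ofFinite G
  obtain ⟨n, d, hd, ⟨e⟩⟩ :=
    IsSemisimpleRing.exists_algEquiv_pi_matrix_of_isAlgClosed ℂ (MonoidAlgebra ℂ G)
  have hclasses := card_conjClasses_le_of_algEquiv e
  have hlinear := card_blocks_one_le_of_algEquiv e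
  have hsquares : Nat.card G = ∑ i, d i ^ 2 := by
    have := e.toLinearEquiv.finrank_eq
    rw [Module.finrank_pi_fintype] at this
    simpa [Module.finrank_matrix, pow_two, Nat.card_eq_fintype_card,
      (MonoidAlgebra.coeffLinearEquiv ℂ).finrank_eq] using this
  have hsum : 9 * n ≤ ∑ i, (d i ^ 2 + if d i = 1 then 8 else 0) := by
    calc 9 * n = ∑ _i : Fin n, 9 := by simp [mul_comm]
      _ ≤ _ := Finset.sum_le_sum fun i _ ↦ by
        have h0 : d i ≠ 0 := NeZero.ne _
        have h2 := block_ne_two_of_algEquiv hodd e i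
        split_ifs with h1
        · simp [h1]
        · have : 3 ≤ d i := by omega
          nlinarith
  rw [Finset.sum_add_distrib, ← hsquares, ← Finset.sum_filter, Finset.sum_const,
    smul_eq_mul] at hsum
  omega

theorem card_commutator_lt_twentyseven (G : Type*) [Group G] [Finite G]
    (hodd : Odd (Nat.card G)) (h : commProb G > 35 / 243) :
    Nat.card (commutator G) < 27 := by
  have hbound := nine_mul_card_conjClasses_le hodd
  have hindex := (commutator G).index_mul_card
  have hpos : 0 < Nat.card G := Nat.card_pos
  rw [commProb_def', gt_iff_lt, div_lt_div_iff₀ (by norm_num) (by exact_mod_cast hpos)] at h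
  have hclasses : 35 * Nat.card G < Nat.card (ConjClasses G) * 243 := by exact_mod_cast h
  by_contra! hlarge
  have := Nat.mul_le_mul_left (commutator G).index hlarge
  omega
end
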